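/- Let P = (p^(1),…,p^(d)) and Q = (q^(1),…,q^(d)) be d-tuples of probability vectors with ∩_{k∈[d]} supp p^(k) ≠ ∅ and ∩_{k∈[d]} supp q^(k) ≠ ∅, and assume supp p^(k) ⊄ supp p^(k′) for all k ≠ k′ in [d] (equivalently, P is power universal). Then the following are equivalent: (i) Φ_{α,supp α}(P) ≤ Φ_{α,supp α}(Q) for every α ∈ A_+ that is not a standard basis vector of ℝ^d; (ii) for every ε > 0 there exist d-tuples of probability vectors Q_ε = (q_ε^(1),…,q_ε^(d)) and R_ε = (r_ε^(1),…,r_ε^(d)), each with nonempty intersection of the supports of its columns, and a stochastic matrix T_ε, such that ‖q^(k) − q_ε^(k)‖₁ ≤ ε and T_ε(r_ε^(k) ⊗ p^(k)) = r_ε^(k) ⊗ q_ε^(k) for all k ∈ [d]; moreover one may take r_ε^(k) = (1/(n+1)) ⊕_{ℓ=0}^{n} (q_ε^(k))^{⊗ℓ} ⊗ (p^(k))^{⊗(n−ℓ)} for n sufficiently large; (iii) for every ε > 0 there exists a d-tuple of probability vectors Q_ε = (q_ε^(1),…,q_ε^(d)) with ∩_{k∈[d]} supp q_ε^(k) ≠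 ∅ and ‖q^(k) − q_ε^(k)‖₁ ≤ ε for all k, such that for all sufficiently large n there is a stochastic matrix T_{ε,n} with T_{ε,n}(p^(k))^{⊗n} = (q_ε^(k))^{⊗n} for all k ∈ [d]. -/

import Mathlib

open Classical

noncomputable section

/-- `p` is a probability vector. -/
def IsProb {I : Type} [Fintype I] (p : I → ℝ) : Prop :=
  (∀ x, 0 ≤ p x) ∧ ∑ x, p x = 1

/-- `T` is a (column-)stochastic matrix (`T y x` is the entry in row `y`, column `x`). -/
def IsStoch {I J : Type} [Fintype I] [Fintype J] (T : J → I → ℝ) : Prop :=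
  (∀ y x, 0 ≤ T y x) ∧ ∀ x, ∑ y, T y x = 1

/-- Kronecker product of two vectors. -/
def kron {I J : Type} (p : I → ℝ) (q : J → ℝ) : I × J → ℝ := fun x => p x.1 * q x.2

/-- `n`-fold Kronecker power `p^{⊗n}`. -/
def kpow {I : Type} (p : I → ℝ) (n : ℕ) : (Fin n → I) → ℝ := fun f => ∏ j, p (f j)

/-- Index type of the catalyst `⊕_{ℓ=0}^{n} (q)^{⊗ℓ} ⊗ (p)^{⊗(n-ℓ)}`
(`I` indexes `p`, `J` indexes `q`). -/
abbrev CatIdx (I J : Type) (n : ℕ) : Type :=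
  (ℓ : Fin (n + 1)) × ((Fin (ℓ : ℕ) → J) × (Fin (n - (ℓ : ℕ)) → I))

/-- The catalyst `r = (1/(n+1)) ⊕_{ℓ=0}^{n} q^{⊗ℓ} ⊗ p^{⊗(n-ℓ)}`. -/
def catVec {I J : Type} (n : ℕ) (p : I → ℝ) (q : J → ℝ) : CatIdx I J n → ℝ :=
  fun x => (1 / (n + 1 : ℝ)) * ((∏ j, q (x.2.1 j)) * ∏ j, p (x.2.2 j))

/-- The multivariate monotone `Φ_{α,C}` (convention `0^0 = 1` of `rpow`). -/
def phiAC {I : Type} [Fintype I] (d : ℕ) (α : Fin d → ℝ) (C : Finset (Fin d))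
    (p : Fin d → I → ℝ) : ℝ :=
  ∑ x ∈ Finset.univ.filter (fun x => ∀ c ∈ C, p c x ≠ 0), ∏ k, p k x ^ α k

/-- The standard basis vector `e_k` of `ℝ^d`. -/
def stdBasis (d : ℕ) (k : Fin d) : Fin d → ℝ := fun j => if j = k then 1 else 0

/-- ℓ¹-distance of vectors. -/
def dist1 {I : Type} [Fintype I] (p q : I → ℝ) : ℝ := ∑ x, |p x - q x|

/-- Hölder's inequality: weighted geometric means are superadditive. -/
theorem sum_prod_rpow_le {ι X : Type} [Fintype ι] (s : Finset X) (α : ι → ℝ)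
    (hα : ∀ k, 0 ≤ α k) (hα1 : ∑ k, α k = 1) (v : ι → X → ℝ) (hv : ∀ k x, 0 ≤ v k x) :
    ∑ x ∈ s, ∏ k, v k x ^ α k ≤ ∏ k, (∑ x ∈ s, v k x) ^ α k := by
  have hV : ∀ k, 0 ≤ ∑ x ∈ s, v k x := fun k => Finset.sum_nonneg fun x _ => hv k x
  by_cases h : ∃ k, α k ≠ 0 ∧ ∑ x ∈ s, v k x = 0
  · obtain ⟨k, hk, h0⟩ := h
    have h1 := (Finset.sum_eq_zero_iff_of_nonneg fun x _ => hv k x).1 h0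
    rw [Finset.sum_eq_zero]
    · exact Finset.prod_nonneg fun k _ => Real.rpow_nonneg (hV k) _
    · intro x hx
      exact Finset.prod_eq_zero (Finset.mem_univ k) (by rw [h1 x hx, Real.zero_rpow hk])
  · push Not at h
    have key : ∀ x ∈ s, ∏ k, v k x ^ α k ≤
        (∏ k, (∑ x ∈ s, v k x) ^ α k) * ∑ k, α k * (v k x / ∑ x ∈ s, v k x) := by
      intro x hx
      have h1 : ∏ k, v k x ^ α k =
          (∏ k, (∑ x ∈ s, v k x) ^ α k) * ∏ k, (v k x / ∑ x ∈ s, v k x) ^ α k := by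
        rw [← Finset.prod_mul_distrib]
        refine Finset.prod_congr rfl fun k _ => ?_
        by_cases hk : α k = 0
        · simp [hk]
        · rw [← Real.mul_rpow (hV k) (div_nonneg (hv k x) (hV k)), mul_div_cancel₀ _ (h k hk)]
      rw [h1]
      refine mul_le_mul_of_nonneg_left ?_
        (Finset.prod_nonneg fun k _ => Real.rpow_nonneg (hV k) _)
      exact Real.geom_mean_le_arith_mean_weighted _ _ _ (fun k _ => hα k) hα1
        fun k _ => div_nonneg (hv k x) (hV k)
    refine (Finset.sum_le_sum key).trans ?_
    rw [← Finset.mul_sum, Finset.sum_comm]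
    have h2 : ∀ k, ∑ x ∈ s, α k * (v k x / ∑ x ∈ s, v k x) = α k := by
      intro k
      by_cases hk : α k = 0
      · simp [hk]
      · rw [← Finset.mul_sum, ← Finset.sum_div, div_self (h k hk), mul_one]
    simp [h2, hα1]

theorem prod_mul_rpow {ι : Type} [Fintype ι] (α : ι → ℝ) (hα : ∀ k, 0 ≤ α k)
    (hα1 : ∑ k, α k = 1) (t : ℝ) (ht : 0 ≤ t) (v : ι → ℝ) (hv : ∀ k, 0 ≤ v k) :
    ∏ k, (t * v k) ^ α k = t * ∏ k, v k ^ α k := by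
  simp_rw [fun k => Real.mul_rpow (z := α k) ht (hv k)]
  rw [Finset.prod_mul_distrib, ← Real.rpow_sum_of_nonneg ht fun k _ => hα k, hα1, Real.rpow_one]

/-- Data processing: weighted geometric means do not decrease under stochastic matrices. -/
theorem sum_prod_rpow_mono {ι X Y : Type} [Fintype ι] [Fintype X] [Fintype Y] (α : ι → ℝ)
    (hα : ∀ k, 0 ≤ α k) (hα1 : ∑ k, α k = 1) (u : ι → X → ℝ) (hu : ∀ k x, 0 ≤ u k x)
    (v : ι → Y → ℝ) (T : Y → X → ℝ) (hT : IsStoch T)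
    (hTu : ∀ k y, ∑ x, T y x * u k x = v k y) :
    ∑ x, ∏ k, u k x ^ α k ≤ ∑ y, ∏ k, v k y ^ α k := by
  calc ∑ x, ∏ k, u k x ^ α k = ∑ x, (∑ y, T y x) * ∏ k, u k x ^ α k := by
        simp [hT.2]
    _ = ∑ y, ∑ x, ∏ k, (T y x * u k x) ^ α k := by
        simp_rw [Finset.sum_mul]
        rw [Finset.sum_comm]
        refine Finset.sum_congr rfl fun y _ => Finset.sum_congr rfl fun x _ => ?_
        rw [prod_mul_rpow α hα hα1 _ (hT.1 y x) _ fun k => hu k x]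
    _ ≤ ∑ y, ∏ k, v k y ^ α k := by
        refine Finset.sum_le_sum fun y _ => ?_
        simp_rw [← hTu]
        exact sum_prod_rpow_le _ α hα hα1 (fun k x => T y x * u k x)
          fun k x => mul_nonneg (hT.1 y x) (hu k x)

theorem phiAC_support {I : Type} [Fintype I] {d : ℕ} (α : Fin d → ℝ) (p : Fin d → I → ℝ) :
    phiAC d α (Finset.univ.filter fun k => α k ≠ 0) p = ∑ x, ∏ k, p k x ^ α k := by
  unfold phiAC
  rw [Finset.sum_filter]
  refine Finset.sum_congr rfl fun x _ => ?_
  split_ifs with h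
  · rfl
  · push Not at h
    obtain ⟨k, hk, h0⟩ := h
    refine (Finset.prod_eq_zero (Finset.mem_univ k) ?_).symm
    rw [h0, Real.zero_rpow (by simpa using hk)]

theorem sum_prod_rpow_kron {ι X Y : Type} [Fintype ι] [Fintype X] [Fintype Y] (α : ι → ℝ)
    (u : ι → X → ℝ) (hu : ∀ k x, 0 ≤ u k x) (v : ι → Y → ℝ) (hv : ∀ k x, 0 ≤ v k x) :
    ∑ z, ∏ k, kron (u k) (v k) z ^ α k =
      (∑ x, ∏ k, u k x ^ α k) * ∑ y, ∏ k, v k y ^ α k := by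
  rw [Fintype.sum_prod_type, Finset.sum_mul_sum]
  refine Finset.sum_congr rfl fun x _ => Finset.sum_congr rfl fun y _ => ?_
  rw [← Finset.prod_mul_distrib]
  exact Finset.prod_congr rfl fun k _ => Real.mul_rpow (hu k x) (hv k y)

theorem prod_kpow_rpow {ι X : Type} [Fintype ι] (α : ι → ℝ) (u : ι → X → ℝ) {n : ℕ}
    (f : Fin n → X) (hu : ∀ k j, 0 ≤ u k (f j)) :
    ∏ k, kpow (u k) n f ^ α k = ∏ j, ∏ k, u k (f j) ^ α k := by
  rw [Finset.prod_comm]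
  exact Finset.prod_congr rfl fun k _ => (Real.finsetProd_rpow _ _ (fun j _ => hu k j) _).symm

theorem sum_prod_rpow_kpow {ι X : Type} [Fintype ι] [Fintype X] (α : ι → ℝ)
    (u : ι → X → ℝ) (hu : ∀ k x, 0 ≤ u k x) (n : ℕ) :
    ∑ f, ∏ k, kpow (u k) n f ^ α k = (∑ x, ∏ k, u k x ^ α k) ^ n := by
  rw [Fintype.sum_pow]
  exact Finset.sum_congr rfl fun f _ => prod_kpow_rpow α u f fun k j => hu k _

theorem kpow_nonneg {X : Type} {u : X → ℝ} (hu : ∀ x, 0 ≤ u x) (n : ℕ) (f : Fin n → X) :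
    0 ≤ kpow u n f := Finset.prod_nonneg fun j _ => hu (f j)

theorem isProb_kpow {X : Type} [Fintype X] {u : X → ℝ} (hu : IsProb u) (n : ℕ) :
    IsProb (kpow u n) :=
  ⟨kpow_nonneg hu.1 n, by
    have := Fintype.sum_pow u n
    rw [hu.2, one_pow] at this
    exact this.symm⟩

theorem sum_prod_rpow_pos {ι X : Type} [Fintype ι] [Fintype X] (α : ι → ℝ)
    (u : ι → X → ℝ) (hu : ∀ k x, 0 ≤ u k x) (h : ∃ x, ∀ k, u k x ≠ 0) :
    0 < ∑ x, ∏ k, u k x ^ α k := by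
  obtain ⟨x, hx⟩ := h
  refine Finset.sum_pos' (fun x _ => Finset.prod_nonneg fun k _ => Real.rpow_nonneg (hu k x) _)
    ⟨x, Finset.mem_univ x, Finset.prod_pos fun k _ => Real.rpow_pos_of_pos ?_ _⟩
  exact lt_of_le_of_ne (hu k x) (hx k).symm

/-- Approximation of `Q` in `ℓ¹` by tuples with larger geometric means passes to the limit. -/
theorem le_sum_prod_rpow_of_approx {ι Y : Type} [Fintype ι] [Fintype Y] (α : ι → ℝ)
    (hα : ∀ k, 0 ≤ α k) (q : ι → Y → ℝ) (c : ℝ)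
    (h : ∀ ε : ℝ, 0 < ε → ∃ qe : ι → Y → ℝ, (∀ k, dist1 (q k) (qe k) ≤ ε) ∧
      c ≤ ∑ y, ∏ k, qe k y ^ α k) :
    c ≤ ∑ y, ∏ k, q k y ^ α k := by
  choose qe h1 h2 using fun n : ℕ => h (1 / (n + 1 : ℝ)) Nat.one_div_pos_of_nat
  refine ge_of_tendsto' (x := Filter.atTop) ?_ h2
  refine tendsto_finsetSum _ fun y _ => tendsto_finsetProd _ fun k _ => ?_
  refine Filter.Tendsto.rpow_const ?_ (Or.inr (hα k))
  rw [tendsto_iff_dist_tendsto_zero]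
  refine squeeze_zero (fun _ => dist_nonneg) (fun n => ?_) tendsto_one_div_add_atTop_nhds_zero_nat
  refine le_trans ?_ (h1 n k)
  rw [dist_comm, Real.dist_eq]
  exact Finset.single_le_sum (f := fun x => |q k x - qe n k x|) (fun _ _ => abs_nonneg _)
    (Finset.mem_univ y)

/-- The face of the standard simplex spanned by the coordinates in `C`. -/
def simplexFace {ι : Type} [Fintype ι] (C : Finset ι) : Set (ι → ℝ) :=
  {α | (∀ k, 0 ≤ α k) ∧ ∑ k, α k = 1 ∧ ∀ k, k ∉ C → α k = 0}

theorem simplexFace_eq {ι : Type} [Fintype ι] (C : Finset ι) :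
    simplexFace C = stdSimplex ℝ ι ∩ {α | ∀ k, k ∉ C → α k = 0} := by
  ext α
  simp [simplexFace, stdSimplex, and_assoc]

theorem isCompact_simplexFace {ι : Type} [Fintype ι] (C : Finset ι) :
    IsCompact (simplexFace C) := by
  rw [simplexFace_eq]
  refine (isCompact_stdSimplex ℝ ι).inter_right ?_
  simp only [Set.ofPred_forall]
  exact isClosed_iInter fun k => isClosed_iInter fun _ =>
    isClosed_eq (continuous_apply k) continuous_const

theorem single_mem_simplexFace {ι : Type} [Fintype ι] {C : Finset ι} {j : ι} (hj : j ∈ C) :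
    (Pi.single j 1 : ι → ℝ) ∈ simplexFace C := by
  refine ⟨fun k => ?_, by simp, fun k hk => ?_⟩
  · by_cases h : k = j
    · subst h; simp
    · simp [h]
  · have : k ≠ j := fun h => hk (h ▸ hj)
    simp [this]

theorem convex_simplexFace {ι : Type} [Fintype ι] (C : Finset ι) : Convex ℝ (simplexFace C) := by
  rw [simplexFace_eq]
  refine (convex_stdSimplex ℝ ι).inter ?_
  intro x hx y hy a b _ _ _ k hk
  simp [hx k hk, hy k hk]

theorem exp_le_one_add_add_sq {x : ℝ} (hx : |x| ≤ 1) : Real.exp x ≤ 1 + x + x ^ 2 := by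
  have := (abs_le.1 (Real.abs_exp_sub_one_sub_id_le hx)).2
  linarith

/-- Chernoff-type estimate at a tilted measure `w` for a function `f` that is nearly nonnegative
on average, in the sense that a small exponential tilt does not decrease the mass. -/
theorem sum_mul_exp_neg_le {J : Type} [Fintype J] (w f : J → ℝ) (hw : ∀ y, 0 ≤ w y)
    {B η s : ℝ} (hη : 0 < η) (hs : 0 < s) (hf : ∀ y, |f y| ≤ B)
    (hs1 : s * (B + η) ≤ 1) (hs2 : s * (B ^ 2 + (B + η) ^ 2) ≤ η / 2)
    (hmin : ∑ y, w y ≤ ∑ y, w y * Real.exp (s * f y)) :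
    ∑ y, w y * Real.exp (-s * (f y + η)) ≤ (1 - s * η / 2) * ∑ y, w y := by
  have h1 : ∀ y, w y * Real.exp (s * f y) + w y * Real.exp (-s * (f y + η)) ≤
      w y * (2 - s * η / 2) := by
    intro y
    have hB := hf y
    have hB0 : 0 ≤ B := (abs_nonneg _).trans hB
    have ha : |s * f y| ≤ 1 := by
      rw [abs_mul, abs_of_pos hs]
      nlinarith
    have hB' : |f y + η| ≤ B + η := by
      refine (abs_add_le _ _).trans ?_
      rw [abs_of_pos hη]; linarith
    have hb : |-s * (f y + η)| ≤ 1 := by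
      rw [abs_mul, abs_neg, abs_of_pos hs]
      nlinarith
    have e1 := exp_le_one_add_add_sq ha
    have e2 := exp_le_one_add_add_sq hb
    have s1 : f y ^ 2 ≤ B ^ 2 := sq_le_sq' (abs_le.1 hB).1 (abs_le.1 hB).2
    have s2 : (f y + η) ^ 2 ≤ (B + η) ^ 2 := sq_le_sq' (abs_le.1 hB').1 (abs_le.1 hB').2
    have s3 : s ^ 2 * (f y ^ 2 + (f y + η) ^ 2) ≤ s * (η / 2) := by
      calc s ^ 2 * (f y ^ 2 + (f y + η) ^ 2) ≤ s ^ 2 * (B ^ 2 + (B + η) ^ 2) := by gcongr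
        _ = s * (s * (B ^ 2 + (B + η) ^ 2)) := by ring
        _ ≤ s * (η / 2) := by gcongr
    rw [← mul_add]
    refine mul_le_mul_of_nonneg_left ?_ (hw y)
    nlinarith
  have h2 := Finset.sum_le_sum fun y (_ : y ∈ Finset.univ) => h1 y
  rw [Finset.sum_add_distrib, ← Finset.sum_mul] at h2
  linarith

/-- If all functions `f j` have small exponential moments under `w`, a probability measure on
`n`-tuples, supported where all the sums of the `f j` are not too negative, is dominated by the
products of `w * exp (f j)` up to an exponential factor. -/
theorem exists_prob_le_prod_mul_exp {ι J : Type} [Fintype ι] [Fintype J] (C : Finset ι)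
    (w : J → ℝ) (hw0 : ∀ y, 0 < w y) (hΦ1 : 1 ≤ ∑ y, w y) (f : ι → J → ℝ) {s η ρ : ℝ}
    (hs : 0 < s) (htilt : ∀ j ∈ C, ∑ y, w y * Real.exp (-s * (f j y + η)) ≤ ρ * ∑ y, w y)
    (hρ : 0 ≤ ρ) (n : ℕ) (hn : (Fintype.card ι : ℝ) * ρ ^ n ≤ 1 / 2) :
    ∃ S : (Fin n → J) → ℝ, (∀ y, 0 ≤ S y) ∧ ∑ y, S y = 1 ∧
      ∀ k ∈ C, ∀ y, S y ≤ 2 * (∏ i, w (y i)) * Real.exp (η * n + ∑ i, f k (y i)) := by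
  have hterm : ∀ j y, 0 ≤ w y * Real.exp (-s * (f j y + η)) :=
    fun j y => mul_nonneg (hw0 y).le (Real.exp_pos _).le
  have hprod : ∀ j (y : Fin n → J), 0 ≤ ∏ i, w (y i) * Real.exp (-s * (f j (y i) + η)) :=
    fun j y => Finset.prod_nonneg fun i _ => hterm j _
  have hW0 : ∀ y : Fin n → J, 0 < ∏ i, w (y i) := fun y => Finset.prod_pos fun i _ => hw0 _
  have hWsum : ∑ y : Fin n → J, ∏ i, w (y i) = (∑ y, w y) ^ n := (Fintype.sum_pow w n).symm
  set Φ := ∑ y, w y with hΦdef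
  set good : Finset (Fin n → J) :=
    Finset.univ.filter fun y => ∀ j ∈ C, -(η * n) ≤ ∑ i, f j (y i) with hgood
  have hbad : ∀ y ∈ goodᶜ, ∏ i, w (y i) ≤
      ∑ j ∈ C, ∏ i, w (y i) * Real.exp (-s * (f j (y i) + η)) := by
    intro y hy
    simp only [hgood, Finset.mem_compl, Finset.mem_filter, Finset.mem_univ, true_and] at hy
    push Not at hy
    obtain ⟨j, hj, hlt⟩ := hy
    refine le_trans ?_ (Finset.single_le_sum (fun j _ => hprod j y) hj)
    rw [Finset.prod_mul_distrib, ← Real.exp_sum _ fun i => -s * (f j (y i) + η),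
      ← Finset.mul_sum, Finset.sum_add_distrib]
    refine le_mul_of_one_le_right (hW0 y).le (Real.one_le_exp ?_)
    simp only [Finset.sum_const, Finset.card_univ, Fintype.card_fin, nsmul_eq_mul]
    nlinarith
  have hbadsum : ∑ y ∈ goodᶜ, ∏ i, w (y i) ≤ Φ ^ n / 2 := by
    calc ∑ y ∈ goodᶜ, ∏ i, w (y i) ≤ ∑ y ∈ goodᶜ, ∑ j ∈ C,
          ∏ i, w (y i) * Real.exp (-s * (f j (y i) + η)) := Finset.sum_le_sum hbad
      _ ≤ ∑ y : Fin n → J, ∑ j ∈ C, ∏ i, w (y i) * Real.exp (-s * (f j (y i) + η)) :=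
          Finset.sum_le_sum_of_subset_of_nonneg (Finset.subset_univ _) fun y _ _ =>
            Finset.sum_nonneg fun j _ => hprod j y
      _ = ∑ j ∈ C, (∑ y, w y * Real.exp (-s * (f j y + η))) ^ n := by
          rw [Finset.sum_comm]
          exact Finset.sum_congr rfl fun j _ =>
            (Fintype.sum_pow (fun y => w y * Real.exp (-s * (f j y + η))) n).symm
      _ ≤ ∑ j ∈ C, (ρ * Φ) ^ n :=
          Finset.sum_le_sum fun j hj =>
            pow_le_pow_left₀ (Finset.sum_nonneg fun y _ => hterm j y) (htilt j hj) n
      _ = C.card * ρ ^ n * Φ ^ n := by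
          rw [Finset.sum_const, nsmul_eq_mul, mul_pow, mul_assoc]
      _ ≤ 1 / 2 * Φ ^ n := by
          refine mul_le_mul_of_nonneg_right (le_trans ?_ hn) (by positivity)
          refine mul_le_mul_of_nonneg_right ?_ (by positivity)
          exact_mod_cast Finset.card_le_univ C
      _ = Φ ^ n / 2 := by ring
  have hgoodsum : 1 / 2 ≤ ∑ y ∈ good, ∏ i, w (y i) := by
    have h1 := Finset.sum_add_sum_compl good fun y => ∏ i, w (y i)
    have h2 : 1 ≤ Φ ^ n := one_le_pow₀ hΦ1
    linarith
  set Z := ∑ y ∈ good, ∏ i, w (y i) with hZ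
  have hZ0 : 0 < Z := by linarith
  refine ⟨fun y => if y ∈ good then (∏ i, w (y i)) / Z else 0, fun y => ?_, ?_,
    fun k hk y => ?_⟩
  · dsimp only
    split_ifs
    · exact div_nonneg (hW0 y).le hZ0.le
    · exact le_rfl
  · rw [← Finset.sum_filter, Finset.filter_mem_eq_inter, Finset.univ_inter, ← Finset.sum_div,
      div_self hZ0.ne']
  · have hWy := hW0 y
    dsimp only
    split_ifs with hy
    · have h1 : -(η * n) ≤ ∑ i, f k (y i) := (Finset.mem_filter.1 hy).2 k hk
      calc (∏ i, w (y i)) / Z ≤ (∏ i, w (y i)) / (1 / 2) := by gcongr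
        _ = 2 * (∏ i, w (y i)) * 1 := by ring
        _ ≤ _ := by
          refine mul_le_mul_of_nonneg_left (Real.one_le_exp ?_) (by positivity)
          linarith
    · positivity

/-- Lower bound in the multi-hypothesis Chernoff theorem: if all weighted geometric means of the
measures `exp (L k)` have mass at least one, then up to a subexponential factor some probability
measure lies below the `n`-fold products of all of them, uniformly in bounded `L`. -/
theorem exists_prob_le_exp {ι J : Type} [Fintype ι] [Fintype J] (C : Finset ι)
    (hC : C.Nonempty) (B η : ℝ) (hB : 0 ≤ B) (hη : 0 < η) :
    ∃ N : ℕ, ∀ n ≥ N, ∀ L : ι → J → ℝ, (∀ k y, |L k y| ≤ B) →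
      (∀ α ∈ simplexFace C, 1 ≤ ∑ y, Real.exp (∑ k, α k * L k y)) →
      ∃ S : (Fin n → J) → ℝ, (∀ y, 0 ≤ S y) ∧ ∑ y, S y = 1 ∧
        ∀ k ∈ C, ∀ y, S y ≤ Real.exp (η * n + ∑ i, L k (y i)) := by
  obtain ⟨s, hs, hs1, hs1', hs2⟩ : ∃ s : ℝ, 0 < s ∧ s ≤ 1 ∧ s * (2 * B + η / 2) ≤ 1 ∧
      s * ((2 * B) ^ 2 + (2 * B + η / 2) ^ 2) ≤ η / 2 / 2 := by
    refine ⟨min 1 (min (1 / (2 * B + η / 2))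
      ((η / 2 / 2) / ((2 * B) ^ 2 + (2 * B + η / 2) ^ 2))), by positivity, min_le_left _ _, ?_, ?_⟩
    · rw [← le_div_iff₀ (by positivity)]
      exact (min_le_right _ _).trans (min_le_left _ _)
    · rw [← le_div_iff₀ (by positivity)]
      exact (min_le_right _ _).trans (min_le_right _ _)
  have hρ0 : 0 ≤ 1 - s * (η / 2) / 2 := by nlinarith
  have hρ1 : 1 - s * (η / 2) / 2 < 1 := by nlinarith
  set ρ := 1 - s * (η / 2) / 2 with hρ
  have ht1 : Filter.Tendsto (fun n : ℕ => (Fintype.card ι : ℝ) * ρ ^ n) Filter.atTop (nhds 0) := by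
    simpa using (tendsto_pow_atTop_nhds_zero_of_lt_one hρ0 hρ1).const_mul (Fintype.card ι : ℝ)
  have ht2 : Filter.Tendsto (fun n : ℕ => Real.exp (η / 2 * n)) Filter.atTop Filter.atTop :=
    Real.tendsto_exp_atTop.comp
      (tendsto_natCast_atTop_atTop.const_mul_atTop (by positivity))
  obtain ⟨N, hN⟩ := Filter.eventually_atTop.1
    ((ht1.eventually_le_const (by norm_num : (0 : ℝ) < 1 / 2)).and (ht2.eventually_ge_atTop 2))
  refine ⟨N, fun n hn L hL hΦ => ?_⟩
  obtain ⟨hn1, hn2⟩ := hN n hn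
  have hcont : Continuous fun α : ι → ℝ => ∑ y, Real.exp (∑ k, α k * L k y) := by fun_prop
  obtain ⟨j₀, hj₀⟩ := hC
  obtain ⟨α, hα, hmin⟩ := (isCompact_simplexFace C).exists_isMinOn
    ⟨_, single_mem_simplexFace hj₀⟩ hcont.continuousOn
  have hℓB : ∀ y, |∑ k, α k * L k y| ≤ B := by
    intro y
    calc |∑ k, α k * L k y| ≤ ∑ k, |α k * L k y| := Finset.abs_sum_le_sum_abs _ _
      _ ≤ ∑ k, α k * B := by
          refine Finset.sum_le_sum fun k _ => ?_
          rw [abs_mul, abs_of_nonneg (hα.1 k)]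
          exact mul_le_mul_of_nonneg_left (hL k y) (hα.1 k)
      _ = B := by rw [← Finset.sum_mul, hα.2.1, one_mul]
  set ℓ : J → ℝ := fun y => ∑ k, α k * L k y with hℓ
  set w : J → ℝ := fun y => Real.exp (ℓ y) with hw
  have hw0 : ∀ y, 0 < w y := fun y => Real.exp_pos _
  have hΦ1 : 1 ≤ ∑ y, w y := hΦ α hα
  set Φ := ∑ y, w y with hΦdef
  have htilt : ∀ j ∈ C, ∑ y, w y * Real.exp (-s * (L j y - ℓ y + η / 2)) ≤ ρ * Φ := by
    intro j hj
    refine sum_mul_exp_neg_le w (fun y => L j y - ℓ y) (fun y => (hw0 y).le) (B := 2 * B)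
      (by positivity) hs (fun y => ?_) hs1' hs2 ?_
    · have h1 := abs_le.1 (hL j y)
      have h2 := abs_le.1 (hℓB y)
      exact abs_le.2 ⟨by linarith [h1.1, h2.2], by linarith [h1.2, h2.1]⟩
    · have hmem := convex_simplexFace C hα (single_mem_simplexFace hj)
        (sub_nonneg.2 hs1) hs.le (by ring : (1 - s) + s = 1)
      refine (hmin hmem).trans_eq ?_
      refine Finset.sum_congr rfl fun y _ => ?_
      rw [hw, ← Real.exp_add]
      congr 1
      simp only [Pi.add_apply, Pi.smul_apply, smul_eq_mul, add_mul, Finset.sum_add_distrib]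
      have e1 : ∑ k, (1 - s) * α k * L k y = (1 - s) * ℓ y := by
        rw [hℓ, Finset.mul_sum]; simp only [mul_assoc]
      have e2 : ∑ k, s * (Pi.single j 1 : ι → ℝ) k * L k y = s * L j y := by
        simp [Pi.single_apply]
      rw [e1, e2]; ring
  obtain ⟨S, hS0, hS1, hS⟩ := exists_prob_le_prod_mul_exp C w hw0 hΦ1
    (fun k y => L k y - ℓ y) hs htilt hρ0 n hn1
  refine ⟨S, hS0, hS1, fun k hk y => (hS k hk y).trans ?_⟩
  have h2 : ∏ i, w (y i) = Real.exp (∑ i, ℓ (y i)) := (Real.exp_sum _ _).symm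
  rw [h2, Finset.sum_sub_distrib]
  calc 2 * Real.exp (∑ i, ℓ (y i)) *
        Real.exp (η / 2 * n + (∑ i, L k (y i) - ∑ i, ℓ (y i)))
      ≤ Real.exp (η / 2 * n) * Real.exp (∑ i, ℓ (y i)) *
        Real.exp (η / 2 * n + (∑ i, L k (y i) - ∑ i, ℓ (y i))) := by gcongr
    _ = Real.exp (η * n + ∑ i, L k (y i)) := by
        rw [← Real.exp_add, ← Real.exp_add]; congr 1; ring

/-- The type (empirical count vector) of a word. -/
def wordType {I : Type} {n : ℕ} (x : Fin n → I) : I → Fin (n + 1) := fun i =>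
  ⟨(Finset.univ.filter fun j => x j = i).card,
    Nat.lt_succ_of_le ((Finset.card_filter_le _ _).trans (by simp))⟩

theorem kpow_eq_of_wordType_eq {I : Type} [Fintype I] {n : ℕ} (u : I → ℝ) {x x' : Fin n → I}
    (h : wordType x = wordType x') : kpow u n x = kpow u n x' := by
  have key : ∀ x : Fin n → I, kpow u n x = ∏ i, u i ^ (wordType x i : ℕ) := by
    intro x
    unfold kpow wordType
    rw [← Finset.prod_fiberwise Finset.univ x fun j => u (x j)]
    refine Finset.prod_congr rfl fun i _ => ?_
    rw [Finset.prod_congr rfl fun j hj => by rw [(Finset.mem_filter.1 hj).2], Finset.prod_const]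
  rw [key, key, h]

/-- A uniform gap between the weighted geometric means of `a` on `A` and those of the positive
tuple `q` allows to map large powers of `a` below the powers of `q`, with any constant factor to
spare. -/
theorem exists_subconversion {ι I J : Type} [Fintype ι] [Fintype I] [Fintype J] (C : Finset ι)
    (hC : C.Nonempty) (A : Finset I) (a : ι → I → ℝ) (ha0 : ∀ k x, 0 ≤ a k x)
    (ha : ∀ k ∈ C, ∀ x ∈ A, 0 < a k x)
    (q : ι → J → ℝ) (hq : ∀ k y, 0 < q k y) (δ : ℝ) (hδ : 0 < δ)
    (hgap : ∀ α ∈ simplexFace C, ∑ x ∈ A, ∏ k, a k x ^ α k ≤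
      Real.exp (-δ) * ∑ y, ∏ k, q k y ^ α k) (M : ℝ) (hM : 0 ≤ M) :
    ∃ N : ℕ, ∀ n ≥ N, ∃ S : (Fin n → J) → (Fin n → I) → ℝ, (∀ y x, 0 ≤ S y x) ∧
      (∀ x ∈ Fintype.piFinset fun _ => A, ∑ y, S y x = 1) ∧
      ∀ k ∈ C, ∀ y, M * ∑ x ∈ Fintype.piFinset fun _ => A, S y x * kpow (a k) n x ≤
        kpow (q k) n y := by
  obtain ⟨Da, hDa⟩ : ∃ D : ℝ, ∀ k, ∀ x, |Real.log (a k x)| ≤ D := by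
    obtain ⟨D, hD⟩ := (Set.finite_range fun z : ι × I => |Real.log (a z.1 z.2)|).bddAbove
    exact ⟨D, fun k x => hD ⟨(k, x), rfl⟩⟩
  obtain ⟨Dq, hDq⟩ : ∃ D : ℝ, ∀ k, ∀ y, |Real.log (q k y)| ≤ D := by
    obtain ⟨D, hD⟩ := (Set.finite_range fun z : ι × J => |Real.log (q z.1 z.2)|).bddAbove
    exact ⟨D, fun k x => hD ⟨(k, x), rfl⟩⟩
  set B : ℝ := Real.log (Fintype.card I) + |Da| + δ + |Dq| with hB
  have hcard0 : 0 ≤ Real.log (Fintype.card I) := Real.log_natCast_nonneg _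
  have hB0 : 0 ≤ B := by positivity
  obtain ⟨N₁, hN₁⟩ := exists_prob_le_exp (J := J) C hC B (δ / 2) hB0 (by positivity)
  have ht : Filter.Tendsto (fun n : ℕ => M * ((n + 1 : ℝ) ^ Fintype.card I * Real.exp (-(δ / 2 * n))))
      Filter.atTop (nhds 0) := by
    have h1 := tendsto_pow_const_mul_const_pow_of_abs_lt_one (Fintype.card I)
      (r := Real.exp (-(δ / 2))) (by
        rw [abs_of_pos (Real.exp_pos _), Real.exp_lt_one_iff]; linarith)
    have h2 := ((Filter.tendsto_add_atTop_iff_nat 1).2 h1).const_mul (M * Real.exp (δ / 2))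
    rw [mul_zero] at h2
    refine h2.congr fun n => ?_
    have h3 : Real.exp (-(δ / 2 * n)) = Real.exp (δ / 2) * Real.exp (-(δ / 2)) ^ (n + 1) := by
      rw [← Real.exp_nat_mul, ← Real.exp_add]
      congr 1
      push_cast
      ring
    rw [h3]
    push_cast
    ring
  obtain ⟨N₂, hN₂⟩ := Filter.eventually_atTop.1
    (ht.eventually_le_const (by norm_num : (0 : ℝ) < 1))
  refine ⟨max 1 (max N₁ N₂), fun n hn => ?_⟩
  have hn0 : 1 ≤ n := (le_max_left _ _).trans hn
  have hn1 : N₁ ≤ n := (le_max_left _ _).trans ((le_max_right _ _).trans hn)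
  have hn2 := hN₂ n ((le_max_right _ _).trans ((le_max_right _ _).trans hn))
  have hnpos : (0 : ℝ) < n := by exact_mod_cast hn0
  set An : Finset (Fin n → I) := Fintype.piFinset fun _ => A with hAn
  have hAnpos : ∀ k ∈ C, ∀ x ∈ An, 0 < kpow (a k) n x := fun k hk x hx =>
    Finset.prod_pos fun j _ => ha k hk _ (Fintype.mem_piFinset.1 hx j)
  -- the target measure attached to a type class
  have hτ : ∀ τ : I → Fin (n + 1), ∃ S : (Fin n → J) → ℝ, (∀ y, 0 ≤ S y) ∧
      ((∃ x ∈ An, wordType x = τ) → ∑ y, S y = 1) ∧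
      ∀ k ∈ C, ∀ y, S y * ∑ x ∈ An with wordType x = τ, kpow (a k) n x ≤
        Real.exp (-(δ / 2 * n)) * kpow (q k) n y := by
    intro τ
    by_cases hx : ∃ x ∈ An, wordType x = τ
    swap
    · refine ⟨0, fun _ => le_rfl, fun h => absurd h hx, fun k _ y => ?_⟩
      have := kpow_nonneg (fun y => (hq k y).le) n y
      simp only [Pi.zero_apply, zero_mul]
      positivity
    obtain ⟨x₀, hx₀, rfl⟩ := hx
    set W := An.filter fun x => wordType x = wordType x₀ with hW
    have hWx : ∀ k, ∀ x ∈ W, kpow (a k) n x = kpow (a k) n x₀ := fun k x hx =>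
      kpow_eq_of_wordType_eq _ (Finset.mem_filter.1 hx).2
    set s : ι → ℝ := fun k => ∑ x ∈ W, kpow (a k) n x with hs
    have hs_eq : ∀ k, s k = W.card * kpow (a k) n x₀ := by
      intro k
      rw [hs]
      dsimp only
      rw [Finset.sum_congr rfl (hWx k), Finset.sum_const, nsmul_eq_mul]
    have hWcard : 1 ≤ W.card := Finset.card_pos.2 ⟨x₀, by simp [hW, hx₀]⟩
    have hWcard' : (0 : ℝ) < W.card := by exact_mod_cast hWcard
    have hspos : ∀ k ∈ C, 0 < s k := fun k hk => by
      rw [hs_eq]; exact mul_pos hWcard' (hAnpos k hk x₀ hx₀)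
    have hslog : ∀ k ∈ C, |Real.log (s k)| ≤ n * (Real.log (Fintype.card I) + |Da|) := by
      intro k hk
      rw [hs_eq, Real.log_mul hWcard'.ne' (hAnpos k hk x₀ hx₀).ne', mul_add]
      refine (abs_add_le _ _).trans (add_le_add ?_ ?_)
      · rw [abs_of_nonneg (Real.log_natCast_nonneg _), ← Real.log_pow]
        refine Real.log_le_log hWcard' ?_
        have := Finset.card_le_univ W
        rw [Fintype.card_fun, Fintype.card_fin] at this
        exact_mod_cast this
      · unfold kpow
        rw [Real.log_prod fun j _ => (ha k hk _ (Fintype.mem_piFinset.1 hx₀ j)).ne']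
        refine (Finset.abs_sum_le_sum_abs _ _).trans ?_
        refine (Finset.sum_le_sum fun j _ => (hDa k (x₀ j)).trans (le_abs_self _)).trans ?_
        simp
    set c : ι → ℝ := fun k => if k ∈ C then -Real.log (s k) / n - δ else 0 with hc
    have hcB : ∀ k, |c k| ≤ Real.log (Fintype.card I) + |Da| + δ := by
      intro k
      simp only [hc]
      split_ifs with hk
      · refine (abs_sub _ _).trans ?_
        rw [abs_of_pos hδ, abs_div, abs_neg, Nat.abs_cast]
        gcongr
        rw [div_le_iff₀ hnpos, mul_comm]
        exact hslog k hk
      · rw [abs_zero]; positivity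
    obtain ⟨S, hS0, hS1, hS⟩ := hN₁ n hn1 (fun k y => c k + Real.log (q k y))
      (fun k y => (abs_add_le _ _).trans
        (add_le_add (hcB k) ((hDq k y).trans (le_abs_self _)))) (by
      intro α hα
      have hlog : ∀ k, ∀ r : ℝ, 0 ≤ r → (k ∈ C → 0 < r) →
          r ^ α k = Real.exp (α k * Real.log r) := by
        intro k r _ hr
        by_cases hk : k ∈ C
        · rw [Real.rpow_def_of_pos (hr hk), mul_comm]
        · simp [hα.2.2 k hk]
      have hsα : ∏ k, s k ^ α k ≤ (∑ x ∈ A, ∏ k, a k x ^ α k) ^ n := by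
        simp_rw [hs_eq]
        rw [prod_mul_rpow α hα.1 hα.2.1 _ hWcard'.le _ fun k => kpow_nonneg (ha0 k) n x₀,
          ← nsmul_eq_mul, ← Finset.sum_const, Finset.sum_pow']
        calc ∑ x ∈ W, ∏ k, kpow (a k) n x₀ ^ α k = ∑ x ∈ W, ∏ j, ∏ k, a k (x j) ^ α k := by
              refine Finset.sum_congr rfl fun x hx => ?_
              rw [← prod_kpow_rpow α a x fun k j => ha0 k _]
              exact Finset.prod_congr rfl fun k _ => by rw [hWx k x hx]
          _ ≤ ∑ x ∈ An, ∏ j, ∏ k, a k (x j) ^ α k :=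
              Finset.sum_le_sum_of_subset_of_nonneg (Finset.filter_subset _ _) fun x _ _ =>
                Finset.prod_nonneg fun j _ => Finset.prod_nonneg fun k _ =>
                  Real.rpow_nonneg (ha0 k _) _
      set Φ := ∑ y, ∏ k, q k y ^ α k with hΦ
      have hΦ0 : 0 ≤ Φ := Finset.sum_nonneg fun y _ => Finset.prod_nonneg fun k _ =>
        Real.rpow_nonneg (hq k y).le _
      have hsplit : ∑ y, Real.exp (∑ k, α k * (c k + Real.log (q k y))) =
          Real.exp (∑ k, α k * c k) * Φ := by
        rw [hΦ, Finset.mul_sum]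
        refine Finset.sum_congr rfl fun y _ => ?_
        simp_rw [mul_add, Finset.sum_add_distrib]
        rw [Real.exp_add, Real.exp_sum _ fun k => α k * Real.log (q k y)]
        congr 1
        exact Finset.prod_congr rfl fun k _ => (hlog k _ (hq k y).le fun _ => hq k y).symm
      have hsexp : ∏ k, s k ^ α k = Real.exp (-(n * (∑ k, α k * c k + δ))) := by
        have h1 : ∀ k, s k ^ α k = Real.exp (-(n * (α k * c k + α k * δ))) := by
          intro k
          rw [hlog k _ (Finset.sum_nonneg fun x _ => kpow_nonneg (ha0 k) n x) (hspos k)]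
          congr 1
          by_cases hk : k ∈ C
          · simp only [hc, if_pos hk]
            field_simp
            ring
          · simp [hα.2.2 k hk]
        rw [Finset.prod_congr rfl fun k _ => h1 k, ← Real.exp_sum, Finset.sum_neg_distrib,
          ← Finset.mul_sum, Finset.sum_add_distrib, ← Finset.sum_mul, hα.2.1, one_mul]
      rw [hsplit, ← one_le_pow_iff_of_nonneg (by positivity) (by omega : n ≠ 0)]
      have h2 := hsα.trans (pow_le_pow_left₀ (Finset.sum_nonneg fun x _ =>
        Finset.prod_nonneg fun k _ => Real.rpow_nonneg (ha0 k x) _) (hgap α hα) n)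
      rw [hsexp] at h2
      have h3 := mul_le_mul_of_nonneg_left h2
        (Real.exp_pos (n * (∑ k, α k * c k + δ))).le
      rw [← Real.exp_add, add_neg_cancel, Real.exp_zero] at h3
      refine h3.trans_eq ?_
      rw [Real.exp_nat_mul, ← mul_pow, ← mul_assoc, ← Real.exp_add]
      congr 3
      ring)
    refine ⟨S, hS0, fun _ => hS1, fun k hk y => ?_⟩
    have hqy : kpow (q k) n y = Real.exp (∑ i, Real.log (q k (y i))) := by
      rw [Real.exp_sum]
      exact Finset.prod_congr rfl fun i _ => (Real.exp_log (hq k _)).symm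
    calc S y * s k ≤ Real.exp (δ / 2 * n + ∑ i, (c k + Real.log (q k (y i)))) *
          Real.exp (Real.log (s k)) := by
          rw [Real.exp_log (hspos k hk)]
          exact mul_le_mul_of_nonneg_right (hS k hk y) (hspos k hk).le
      _ = Real.exp (-(δ / 2 * n)) * kpow (q k) n y := by
          rw [hqy, ← Real.exp_add, ← Real.exp_add]
          congr 1
          simp only [Finset.sum_add_distrib, hc, if_pos hk, Finset.sum_const, Finset.card_univ,
            Fintype.card_fin, nsmul_eq_mul]
          field_simp
          ring
  choose S hS0 hS1 hS using hτ
  refine ⟨fun y x => S (wordType x) y, fun y x => hS0 _ y, fun x hx => hS1 _ ⟨x, hx, rfl⟩,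
    fun k hk y => ?_⟩
  have hqy := kpow_nonneg (fun y => (hq k y).le) n y
  rw [← Finset.sum_fiberwise An wordType]
  have h1 : ∀ τ : I → Fin (n + 1), ∑ x ∈ An with wordType x = τ, S (wordType x) y * kpow (a k) n x
      ≤ Real.exp (-(δ / 2 * n)) * kpow (q k) n y := by
    intro τ
    refine le_trans (le_of_eq ?_) (hS τ k hk y)
    rw [Finset.mul_sum]
    exact Finset.sum_congr rfl fun x hx => by rw [(Finset.mem_filter.1 hx).2]
  calc _ ≤ M * ∑ τ : I → Fin (n + 1), Real.exp (-(δ / 2 * n)) * kpow (q k) n y :=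
        mul_le_mul_of_nonneg_left (Finset.sum_le_sum fun τ _ => h1 τ) hM
    _ = M * ((n + 1 : ℝ) ^ Fintype.card I * Real.exp (-(δ / 2 * n))) * kpow (q k) n y := by
        simp only [Finset.sum_const, Finset.card_univ, Fintype.card_fun, Fintype.card_fin,
          nsmul_eq_mul]
        push_cast
        ring
    _ ≤ kpow (q k) n y := mul_le_of_le_one_left hqy hn2

/-- The tuple `u` can be converted into the tuple `v` by a stochastic matrix. -/
def Convertible {ι X Y : Type} [Fintype X] [Fintype Y] (u : ι → X → ℝ) (v : ι → Y → ℝ) : Prop :=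
  ∃ T : Y → X → ℝ, IsStoch T ∧ ∀ k y, ∑ x, T y x * u k x = v k y

namespace Convertible

variable {ι X Y Z : Type} [Fintype X] [Fintype Y] [Fintype Z]

theorem of_equiv {u : ι → X → ℝ} {v : ι → Y → ℝ} (e : X ≃ Y) (h : ∀ k x, v k (e x) = u k x) :
    Convertible u v := by
  refine ⟨fun y x => if e x = y then 1 else 0, ⟨fun y x => by dsimp only; split_ifs <;> norm_num,
    fun x => by simp⟩, fun k y => ?_⟩
  obtain ⟨x, rfl⟩ := e.surjective y
  simp [h]

theorem trans {u : ι → X → ℝ} {v : ι → Y → ℝ} {w : ι → Z → ℝ} (h₁ : Convertible u v)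
    (h₂ : Convertible v w) : Convertible u w := by
  obtain ⟨T, hT, hTu⟩ := h₁
  obtain ⟨S, hS, hSv⟩ := h₂
  refine ⟨fun z x => ∑ y, S z y * T y x, ⟨fun z x => Finset.sum_nonneg fun y _ =>
    mul_nonneg (hS.1 z y) (hT.1 y x), fun x => ?_⟩, fun k z => ?_⟩
  · rw [Finset.sum_comm]
    simp [← Finset.sum_mul, hS.2, hT.2]
  · simp_rw [Finset.sum_mul, mul_assoc]
    rw [Finset.sum_comm]
    simp_rw [← Finset.mul_sum, hTu, hSv]

theorem const_mul {u : ι → X → ℝ} {v : ι → Y → ℝ} (h : Convertible u v) (c : ℝ) :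
    Convertible (fun k x => c * u k x) (fun k y => c * v k y) := by
  obtain ⟨T, hT, hTu⟩ := h
  refine ⟨T, hT, fun k y => ?_⟩
  simp_rw [← hTu, Finset.mul_sum, mul_left_comm]

theorem sigma {L L' : Type} [Fintype L] [Fintype L'] {X : L → Type} {Y : L' → Type}
    [∀ l, Fintype (X l)] [∀ l, Fintype (Y l)] (π : L ≃ L') {u : ι → (Σ l, X l) → ℝ}
    {v : ι → (Σ l, Y l) → ℝ}
    (h : ∀ l, Convertible (fun k x => u k ⟨l, x⟩) (fun k y => v k ⟨π l, y⟩)) :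
    Convertible u v := by
  choose t ht htu using h
  refine ⟨fun y x => if h : π x.1 = y.1 then t x.1 (h ▸ y.2) x.2 else 0, ⟨?_, ?_⟩, ?_⟩
  · rintro ⟨l', y⟩ ⟨l, x⟩
    obtain ⟨l₀, rfl⟩ := π.surjective l'
    dsimp only
    split_ifs with h
    · exact (ht l).1 _ _
    · exact le_rfl
  · rintro ⟨l, x⟩
    rw [Fintype.sum_sigma, Finset.sum_eq_single (π l)]
    · simpa using (ht l).2 x
    · intro l' _ hl'
      simp [hl'.symm]
    · simp
  · rintro k ⟨l', y⟩
    obtain ⟨l, rfl⟩ := π.surjective l'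
    rw [Fintype.sum_sigma, Finset.sum_eq_single l]
    · simpa using htu l k y
    · intro l' _ hl'
      simp [hl']
    · simp

end Convertible

theorem exists_equiv_prod_fun (X : Type) {a b : ℕ} (h : a = b + 1) :
    ∃ e : (Fin b → X) × X ≃ (Fin a → X),
      ∀ (u : X → ℝ) (x : (Fin b → X) × X), ∏ j, u (e x j) = (∏ j, u (x.1 j)) * u x.2 := by
  subst h
  refine ⟨(Equiv.prodComm _ _).trans (Fin.snocEquiv fun _ => X), fun u x => ?_⟩
  rw [Fin.prod_univ_castSucc]
  simp [Fin.snocEquiv]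

section Catalyst

variable {ι I J : Type} [Fintype I] [Fintype J] (p : ι → I → ℝ) (q : ι → J → ℝ) (c : ℝ)

theorem convertible_shift {a b a' b' : ℕ} (ha : a = a' + 1) (hb : b' = b + 1) :
    Convertible
      (fun k (x : ((Fin a → J) × (Fin b → I)) × I) =>
        c * ((∏ j, q k (x.1.1 j)) * ∏ j, p k (x.1.2 j)) * p k x.2)
      (fun k (x : ((Fin a' → J) × (Fin b' → I)) × J) =>
        c * ((∏ j, q k (x.1.1 j)) * ∏ j, p k (x.1.2 j)) * q k x.2) := by
  obtain ⟨e, he⟩ := exists_equiv_prod_fun I hb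
  obtain ⟨f, hf⟩ := exists_equiv_prod_fun J ha
  refine Convertible.of_equiv
    { toFun := fun x => (((f.symm x.1.1).1, e (x.1.2, x.2)), (f.symm x.1.1).2)
      invFun := fun y => ((f (y.1.1, y.2), (e.symm y.1.2).1), (e.symm y.1.2).2)
      left_inv := fun x => by simp
      right_inv := fun y => by simp } ?_
  rintro k ⟨⟨a, b⟩, i⟩
  obtain ⟨⟨a, j⟩, rfl⟩ := f.surjective a
  simp only [Equiv.coe_fn_mk, Equiv.symm_apply_apply, he, hf]
  ring

theorem convertible_power {a b a' b' n : ℕ} (ha : a = 0) (hb : n = b + 1) (ha' : n = a' + 1)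
    (hb' : b' = 0) (h : Convertible (fun k => kpow (p k) n) (fun k => kpow (q k) n)) :
    Convertible
      (fun k (x : ((Fin a → J) × (Fin b → I)) × I) =>
        c * ((∏ j, q k (x.1.1 j)) * ∏ j, p k (x.1.2 j)) * p k x.2)
      (fun k (x : ((Fin a' → J) × (Fin b' → I)) × J) =>
        c * ((∏ j, q k (x.1.1 j)) * ∏ j, p k (x.1.2 j)) * q k x.2) := by
  subst ha hb'
  obtain ⟨e, he⟩ := exists_equiv_prod_fun I hb
  obtain ⟨f, hf⟩ := exists_equiv_prod_fun J ha'
  refine (Convertible.of_equiv (((Equiv.uniqueProd _ _).prodCongr (Equiv.refl I)).trans e)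
    ?_).trans ((h.const_mul c).trans (Convertible.of_equiv
      (((Equiv.prodUnique _ _).prodCongr (Equiv.refl J)).trans f).symm ?_))
  · rintro k ⟨⟨a, b⟩, i⟩
    simp [kpow, he, mul_assoc]
  · intro k x
    obtain ⟨⟨a, j⟩, rfl⟩ := f.surjective x
    simp [kpow, hf, mul_assoc]

/-- Conversion of the `(n+1)`-st powers yields conversion catalysed by `catVec n`. -/
theorem convertible_kron_catVec (n : ℕ)
    (h : Convertible (fun k => kpow (p k) (n + 1)) (fun k => kpow (q k) (n + 1))) :
    Convertible (fun k => kron (catVec n (p k) (q k)) (p k))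
      (fun k => kron (catVec n (p k) (q k)) (q k)) := by
  refine (Convertible.of_equiv (Equiv.sigmaProdDistrib _ _) (v := fun k x =>
    kron (catVec n (p k) (q k)) (p k) ((Equiv.sigmaProdDistrib _ _).symm x))
      fun k x => by simp).trans (Convertible.trans (v := fun k x =>
    kron (catVec n (p k) (q k)) (q k) ((Equiv.sigmaProdDistrib _ _).symm x)) ?_
      (Convertible.of_equiv (Equiv.sigmaProdDistrib _ _).symm fun k x => rfl))
  refine Convertible.sigma (finRotate (n + 1)).symm fun l => ?_
  refine Fin.cases ?_ (fun m => ?_) l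
  · have hrot : (finRotate (n + 1)).symm 0 = Fin.last n := by
      rw [Equiv.symm_apply_eq, finRotate_last]
    rw [hrot]
    exact convertible_power p q _ (by simp) (by simp) (by simp) (by simp) h
  · have hrot : (finRotate (n + 1)).symm m.succ = m.castSucc := by
      rw [Equiv.symm_apply_eq, finRotate_apply, Fin.coeSucc_eq_succ]
    rw [hrot]
    exact convertible_shift p q _ (by simp) (by simp; omega)

end Catalyst

theorem isProb_catVec {I J : Type} [Fintype I] [Fintype J] {p : I → ℝ} {q : J → ℝ}
    (hp : IsProb p) (hq : IsProb q) (n : ℕ) : IsProb (catVec n p q) := by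
  refine ⟨fun x => mul_nonneg (by positivity) (mul_nonneg
    (Finset.prod_nonneg fun j _ => hq.1 _) (Finset.prod_nonneg fun j _ => hp.1 _)), ?_⟩
  have h1 : ∀ l : Fin (n + 1), ∑ x : (Fin (l : ℕ) → J) × (Fin (n - (l : ℕ)) → I),
      catVec n p q ⟨l, x⟩ = 1 / (n + 1 : ℝ) := by
    intro l
    have hP := Fintype.sum_pow p (n - (l : ℕ))
    have hQ := Fintype.sum_pow q (l : ℕ)
    rw [hp.2, one_pow] at hP
    rw [hq.2, one_pow] at hQ
    have h2 : ∀ x : (Fin (l : ℕ) → J) × (Fin (n - (l : ℕ)) → I), catVec n p q ⟨l, x⟩ =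
        1 / (n + 1 : ℝ) * ((∏ j, q (x.1 j)) * ∏ j, p (x.2 j)) := fun _ => rfl
    simp only [h2, Fintype.sum_prod_type, ← Finset.mul_sum, ← hP, ← hQ, mul_one]
  rw [Fintype.sum_sigma]
  simp only [h1, Finset.sum_const, Finset.card_univ, Fintype.card_fin, nsmul_eq_mul]
  push_cast
  field_simp

/-- Completing a partial conversion: outcomes that are possible for at most one of the hypotheses
can be used to prepare the part of the target that is not yet covered. -/
theorem convertible_of_partial {ι I J : Type} [Fintype ι] [Fintype I] [Fintype J] [Nonempty ι]
    (P : ι → I → ℝ) (Q : ι → J → ℝ) (hP : ∀ k, IsProb (P k)) (hQ : ∀ k, IsProb (Q k))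
    (G : Finset I) (hG : ∀ x ∉ G, ∀ k k', P k x ≠ 0 → P k' x ≠ 0 → k = k')
    (S : J → I → ℝ) (hS0 : ∀ y x, 0 ≤ S y x) (hS1 : ∀ x ∈ G, ∑ y, S y x = 1)
    (hS : ∀ k y, ∑ x ∈ G, S y x * P k x ≤ Q k y) : Convertible P Q := by
  set D : ι → J → ℝ := fun k y => Q k y - ∑ x ∈ G, S y x * P k x with hD
  have hD0 : ∀ k y, 0 ≤ D k y := fun k y => sub_nonneg.2 (hS k y)
  have hmass : ∀ k, ∑ y, D k y = ∑ x ∈ Gᶜ, P k x := by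
    intro k
    have h1 : ∑ y, ∑ x ∈ G, S y x * P k x = ∑ x ∈ G, P k x := by
      rw [Finset.sum_comm]
      refine Finset.sum_congr rfl fun x hx => ?_
      rw [← Finset.sum_mul, hS1 x hx, one_mul]
    have h2 := Finset.sum_add_sum_compl G (P k)
    rw [(hP k).2] at h2
    simp only [hD, Finset.sum_sub_distrib, h1, (hQ k).2]
    linarith
  have hk : ∀ x, ∃ k, x ∉ G → ∀ k', P k' x ≠ 0 → k' = k := by
    intro x
    by_cases h : ∃ k, P k x ≠ 0
    · obtain ⟨k, hk⟩ := h
      exact ⟨k, fun hx k' hk' => hG x hx k' k hk' hk⟩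
    · push Not at h
      exact ⟨Classical.arbitrary ι, fun _ k' hk' => absurd (h k') hk'⟩
  choose κ hκ using hk
  refine ⟨fun y x => if x ∈ G then S y x else
    if ∑ y, D (κ x) y = 0 then Q (κ x) y else D (κ x) y / ∑ y, D (κ x) y,
    ⟨fun y x => ?_, fun x => ?_⟩, fun k y => ?_⟩
  · dsimp only
    split_ifs
    · exact hS0 y x
    · exact (hQ _).1 y
    · exact div_nonneg (hD0 _ _) (Finset.sum_nonneg fun y _ => hD0 _ y)
  · dsimp only
    split_ifs with h1 h2
    · exact hS1 x h1
    · exact (hQ _).2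
    · rw [← Finset.sum_div, div_self h2]
  · rw [← Finset.sum_add_sum_compl G]
    have e1 : ∑ x ∈ G, (if x ∈ G then S y x else
        if ∑ y, D (κ x) y = 0 then Q (κ x) y else D (κ x) y / ∑ y, D (κ x) y) * P k x =
        ∑ x ∈ G, S y x * P k x :=
      Finset.sum_congr rfl fun x hx => by rw [if_pos hx]
    have e2 : ∑ x ∈ Gᶜ, (if x ∈ G then S y x else
        if ∑ y, D (κ x) y = 0 then Q (κ x) y else D (κ x) y / ∑ y, D (κ x) y) * P k x =
        ∑ x ∈ Gᶜ, (D k y / ∑ y, D k y) * P k x := by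
      refine Finset.sum_congr rfl fun x hx => ?_
      by_cases hx0 : P k x = 0
      · simp [hx0]
      · have hxG : x ∉ G := by simpa using hx
        rw [if_neg hxG, ← hκ x hxG k hx0, if_neg]
        rw [hmass k]
        refine ne_of_gt (Finset.sum_pos' (fun x _ => (hP k).1 x) ⟨x, hx, ?_⟩)
        exact lt_of_le_of_ne ((hP k).1 x) (Ne.symm hx0)
    rw [e1, e2, ← Finset.mul_sum, ← hmass k]
    by_cases h0 : ∑ y, D k y = 0
    · have := (Finset.sum_eq_zero_iff_of_nonneg fun y _ => hD0 k y).1 h0 y (Finset.mem_univ y)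
      rw [h0, mul_zero, add_zero]
      simp only [hD] at this
      linarith
    · rw [div_mul_cancel₀ _ h0]
      simp only [hD]
      ring

/-- Mixing with the uniform distribution `u` makes the weighted geometric means strictly larger
than those of the source on every face of the simplex, with a uniform gap. -/
theorem exists_gap {ι I J : Type} [Fintype ι] [Fintype I] [Fintype J] [Nonempty J]
    (p : ι → I → ℝ) (hp : ∀ k, IsProb (p k)) (q : ι → J → ℝ) (hq : ∀ k, IsProb (q k))
    (hpu : ∀ k k' : ι, k ≠ k' → ¬ ({x | p k x ≠ 0} ⊆ {x | p k' x ≠ 0}))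
    (hpq : ∀ α : ι → ℝ, (∀ k, 0 ≤ α k) → ∑ k, α k = 1 →
      ∑ x, ∏ k, p k x ^ α k ≤ ∑ y, ∏ k, q k y ^ α k)
    (t : ℝ) (ht0 : 0 < t) (ht1 : t ≤ 1) (C : Finset ι) (hC : 2 ≤ C.card) :
    ∃ δ : ℝ, 0 < δ ∧ ∀ α ∈ simplexFace C,
      ∑ x with ∀ k ∈ C, p k x ≠ 0, ∏ k, p k x ^ α k ≤
        Real.exp (-δ) * ∑ y, ∏ k, ((1 - t) * q k y + t * (1 / Fintype.card J)) ^ α k := by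
  set A : Finset I := Finset.univ.filter fun x => ∀ k ∈ C, p k x ≠ 0 with hA
  set u : ℝ := 1 / Fintype.card J with hu
  have hu0 : 0 < u := by positivity
  have hq' : ∀ k y, 0 < (1 - t) * q k y + t * u := fun k y =>
    add_pos_of_nonneg_of_pos (mul_nonneg (by linarith) ((hq k).1 y)) (by positivity)
  have hs1 : ∀ k, ∑ x ∈ A, p k x ≤ 1 := fun k => by
    rw [← (hp k).2]
    exact Finset.sum_le_sum_of_subset_of_nonneg (Finset.subset_univ _) fun x _ _ => (hp k).1 x
  have hs : ∀ k ∈ C, ∑ x ∈ A, p k x < 1 := by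
    intro k hk
    obtain ⟨k', hk', hne⟩ := Finset.exists_mem_ne (by omega : 1 < C.card) k
    obtain ⟨x, hx, hx'⟩ := Set.not_subset.1 (hpu k k' hne.symm)
    rw [← (hp k).2]
    refine Finset.sum_lt_sum_of_subset (Finset.subset_univ _) (Finset.mem_univ x) ?_
      (lt_of_le_of_ne ((hp k).1 x) (Ne.symm hx)) fun x _ _ => (hp k).1 x
    intro hxA
    exact hx' ((Finset.mem_filter.1 hxA).2 k' hk')
  have hprod : ∀ (α : ι → ℝ) x, 0 ≤ ∏ k, p k x ^ α k := fun α x =>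
    Finset.prod_nonneg fun k _ => Real.rpow_nonneg ((hp k).1 x) _
  have hH0 : ∀ α : ι → ℝ, 0 < ∑ y, ∏ k, ((1 - t) * q k y + t * u) ^ α k := fun α =>
    Finset.sum_pos (fun y _ => Finset.prod_pos fun k _ => Real.rpow_pos_of_pos (hq' k y) _)
      Finset.univ_nonempty
  have hlt : ∀ α ∈ simplexFace C, ∑ x ∈ A, ∏ k, p k x ^ α k <
      ∑ y, ∏ k, ((1 - t) * q k y + t * u) ^ α k := by
    rintro α ⟨hα, hα1, hαC⟩
    have hF1 : ∑ x ∈ A, ∏ k, p k x ^ α k < 1 := by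
      calc ∑ x ∈ A, ∏ k, p k x ^ α k ≤ ∑ x ∈ A, ∑ k, α k * p k x :=
            Finset.sum_le_sum fun x _ => Real.geom_mean_le_arith_mean_weighted _ _ _
              (fun k _ => hα k) hα1 fun k _ => (hp k).1 x
        _ = ∑ k, α k * ∑ x ∈ A, p k x := by
            rw [Finset.sum_comm]
            simp_rw [Finset.mul_sum]
        _ < ∑ k, α k := by
            obtain ⟨k, -, hk⟩ : ∃ k ∈ Finset.univ, α k ≠ 0 :=
              Finset.exists_ne_zero_of_sum_ne_zero (by rw [hα1]; exact one_ne_zero)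
            refine Finset.sum_lt_sum (fun k _ => mul_le_of_le_one_right (hα k) (hs1 k))
              ⟨k, Finset.mem_univ k, mul_lt_of_lt_one_right
                (lt_of_le_of_ne (hα k) hk.symm) (hs k ?_)⟩
            by_contra hkC
            exact hk (hαC k hkC)
        _ = 1 := hα1
    have hFq : ∑ x ∈ A, ∏ k, p k x ^ α k ≤ ∑ y, ∏ k, q k y ^ α k :=
      (Finset.sum_le_sum_of_subset_of_nonneg (Finset.subset_univ _)
        fun x _ _ => hprod α x).trans (hpq α hα hα1)
    have hconc : (1 - t) * ∑ y, ∏ k, q k y ^ α k + t ≤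
        ∑ y, ∏ k, ((1 - t) * q k y + t * u) ^ α k := by
      have h1 : ∀ y, (1 - t) * ∏ k, q k y ^ α k + t * u ≤
          ∏ k, ((1 - t) * q k y + t * u) ^ α k := by
        intro y
        have h2 := sum_prod_rpow_le (Finset.univ : Finset Bool) α hα hα1
          (fun k b => if b then (1 - t) * q k y else t * u) (fun k b => by
            cases b
            · simpa using by positivity
            · simpa using mul_nonneg (by linarith) ((hq k).1 y))
        simp only [Fintype.sum_bool, if_true, Bool.false_eq_true, if_false] at h2
        rw [prod_mul_rpow α hα hα1 _ (by linarith) _ fun k => (hq k).1 y,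
          prod_mul_rpow α hα hα1 _ ht0.le _ fun k => hu0.le,
          ← Real.rpow_sum_of_nonneg hu0.le fun k _ => hα k, hα1, Real.rpow_one] at h2
        exact h2
      have h3 := Finset.sum_le_sum fun y (_ : y ∈ Finset.univ) => h1 y
      rw [Finset.sum_add_distrib, ← Finset.mul_sum, Finset.sum_const, Finset.card_univ,
        nsmul_eq_mul] at h3
      refine le_trans (le_of_eq ?_) h3
      rw [hu]
      field_simp
    nlinarith
  have hcont : ContinuousOn (fun α : ι → ℝ => (∑ x ∈ A, ∏ k, p k x ^ α k) /
      ∑ y, ∏ k, ((1 - t) * q k y + t * u) ^ α k) (simplexFace C) := by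
    refine ContinuousOn.div ?_ ?_ fun α _ => (hH0 α).ne'
    · refine continuousOn_finsetSum _ fun x hx => continuousOn_finsetProd _ fun k _ => ?_
      by_cases hk : k ∈ C
      · exact (continuous_const.rpow (continuous_apply k)
          (fun α => Or.inl ((Finset.mem_filter.1 hx).2 k hk))).continuousOn
      · refine continuousOn_const (c := (1 : ℝ)) |>.congr fun α hα => ?_
        simp [hα.2.2 k hk]
    · refine continuousOn_finsetSum _ fun y _ => continuousOn_finsetProd _ fun k _ => ?_
      exact (continuous_const.rpow (continuous_apply k) fun α => Or.inl (hq' k y).ne').continuousOn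
  obtain ⟨j, hj⟩ := Finset.card_pos.1 (by omega : 0 < C.card)
  obtain ⟨α₀, hα₀, hmax⟩ := (isCompact_simplexFace C).exists_isMaxOn
    ⟨_, single_mem_simplexFace hj⟩ hcont
  set m := (∑ x ∈ A, ∏ k, p k x ^ α₀ k) /
      ∑ y, ∏ k, ((1 - t) * q k y + t * u) ^ α₀ k with hm
  have hm1 : m < 1 := (div_lt_one (hH0 α₀)).2 (hlt α₀ hα₀)
  have hm2 : 0 < max m (1 / 2) := lt_max_of_lt_right (by norm_num)
  refine ⟨-Real.log (max m (1 / 2)), ?_, fun α hα => ?_⟩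
  · rw [Left.neg_pos_iff]
    exact Real.log_neg hm2 (max_lt hm1 (by norm_num))
  · rw [neg_neg, Real.exp_log hm2, ← div_le_iff₀ (hH0 α)]
    exact (hmax hα).trans (le_max_left _ _)

/-- Large powers of `p` can be converted into powers of the slightly mixed tuple `q`. -/
theorem exists_convertible_kpow {ι I J : Type} [Fintype ι] [Nonempty ι] [Fintype I] [Fintype J]
    [Nonempty J] (p : ι → I → ℝ) (hp : ∀ k, IsProb (p k)) (q : ι → J → ℝ)
    (hq : ∀ k, IsProb (q k))
    (hpu : ∀ k k' : ι, k ≠ k' → ¬ ({x | p k x ≠ 0} ⊆ {x | p k' x ≠ 0}))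
    (hpq : ∀ α : ι → ℝ, (∀ k, 0 ≤ α k) → ∑ k, α k = 1 →
      ∑ x, ∏ k, p k x ^ α k ≤ ∑ y, ∏ k, q k y ^ α k) (ε : ℝ) (hε : 0 < ε) :
    ∃ qe : ι → J → ℝ, (∀ k, IsProb (qe k)) ∧ (∃ y, ∀ k, qe k y ≠ 0) ∧
      (∀ k, dist1 (q k) (qe k) ≤ ε) ∧
      ∃ N : ℕ, ∀ n ≥ N, Convertible (fun k => kpow (p k) n) (fun k => kpow (qe k) n) := by
  obtain ⟨t, ht0, ht1, ht2⟩ : ∃ t : ℝ, 0 < t ∧ t ≤ 1 ∧ t * 2 ≤ ε :=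
    ⟨min 1 (ε / 2), by positivity, min_le_left _ _, by linarith [min_le_right 1 (ε / 2)]⟩
  set u : ℝ := 1 / Fintype.card J with hu
  have hu0 : 0 < u := by positivity
  have hu1 : ∑ _y : J, u = 1 := by
    rw [Finset.sum_const, Finset.card_univ, nsmul_eq_mul, hu]
    field_simp
  set qe : ι → J → ℝ := fun k y => (1 - t) * q k y + t * u with hqe
  have hqe0 : ∀ k y, 0 < qe k y := fun k y =>
    add_pos_of_nonneg_of_pos (mul_nonneg (by linarith) ((hq k).1 y)) (by positivity)
  have hqeP : ∀ k, IsProb (qe k) := fun k => ⟨fun y => (hqe0 k y).le, by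
    simp only [hqe]
    rw [Finset.sum_add_distrib, ← Finset.mul_sum, ← Finset.mul_sum, (hq k).2, hu1]
    ring⟩
  refine ⟨qe, hqeP, ⟨Classical.arbitrary J, fun k => (hqe0 k _).ne'⟩, fun k => ?_, ?_⟩
  · refine le_trans ?_ ht2
    calc dist1 (q k) (qe k) ≤ ∑ y, t * (q k y + u) := by
          refine Finset.sum_le_sum fun y _ => ?_
          have h1 : q k y - qe k y = t * (q k y - u) := by simp only [hqe]; ring
          rw [h1, abs_mul, abs_of_pos ht0]
          refine mul_le_mul_of_nonneg_left ((abs_sub _ _).trans ?_) ht0.le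
          rw [abs_of_nonneg ((hq k).1 y), abs_of_pos hu0]
      _ = t * 2 := by
          rw [← Finset.mul_sum, Finset.sum_add_distrib, (hq k).2, hu1]
          norm_num
  · have hsub : ∀ C : Finset ι, ∃ N : ℕ, ∀ n ≥ N, ∃ S : (Fin n → J) → (Fin n → I) → ℝ,
        2 ≤ C.card → (∀ y x, 0 ≤ S y x) ∧
        (∀ x ∈ Fintype.piFinset fun _ => Finset.univ.filter fun x => ∀ k ∈ C, p k x ≠ 0,
          ∑ y, S y x = 1) ∧
        ∀ k ∈ C, ∀ y, (Fintype.card (Finset ι) : ℝ) *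
          ∑ x ∈ Fintype.piFinset fun _ => Finset.univ.filter fun x => ∀ k ∈ C, p k x ≠ 0,
            S y x * kpow (p k) n x ≤ kpow (qe k) n y := by
      intro C
      by_cases hC : 2 ≤ C.card
      · obtain ⟨δ, hδ, hgap⟩ := exists_gap p hp q hq hpu hpq t ht0 ht1 C hC
        obtain ⟨N, hN⟩ := exists_subconversion C (Finset.card_pos.1 (by omega))
          (Finset.univ.filter fun x => ∀ k ∈ C, p k x ≠ 0) p
          (fun k => (hp k).1) (fun k hk x hx => lt_of_le_of_ne ((hp k).1 x)
            (Ne.symm ((Finset.mem_filter.1 hx).2 k hk))) qe hqe0 δ hδ hgap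
          (Fintype.card (Finset ι)) (Nat.cast_nonneg _)
        refine ⟨N, fun n hn => ?_⟩
        obtain ⟨S, hS⟩ := hN n hn
        exact ⟨S, fun _ => hS⟩
      · exact ⟨0, fun n _ => ⟨0, fun h => absurd h hC⟩⟩
    choose N hN using hsub
    refine ⟨Finset.univ.sup N, fun n hn => ?_⟩
    choose S hS using fun C => hN C n ((Finset.le_sup (Finset.mem_univ C)).trans hn)
    set h : (Fin n → I) → Finset ι := fun x => Finset.univ.filter fun k => kpow (p k) n x ≠ 0
      with hh
    have hmem : ∀ x, x ∈ Fintype.piFinset fun _ : Fin n =>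
        Finset.univ.filter fun i => ∀ k ∈ h x, p k i ≠ 0 := by
      intro x
      refine Fintype.mem_piFinset.2 fun j => Finset.mem_filter.2 ⟨Finset.mem_univ _, ?_⟩
      intro k hk
      exact Finset.prod_ne_zero_iff.1 (Finset.mem_filter.1 hk).2 j (Finset.mem_univ j)
    have hp0 : ∀ k (x : Fin n → I), 0 ≤ kpow (p k) n x := fun k => kpow_nonneg (hp k).1 n
    refine convertible_of_partial _ _ (fun k => isProb_kpow (hp k) n)
      (fun k => isProb_kpow (hqeP k) n) (Finset.univ.filter fun x => 2 ≤ (h x).card) ?_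
      (fun y x => if 2 ≤ (h x).card then S (h x) y x else 0) ?_ ?_ ?_
    · intro x hx k k' hk hk'
      have hx' : (h x).card ≤ 1 := by
        simp only [Finset.mem_filter, Finset.mem_univ, true_and] at hx
        omega
      exact Finset.card_le_one.1 hx' k (by simpa [hh] using hk) k' (by simpa [hh] using hk')
    · intro y x
      split_ifs with hc
      · exact (hS _ hc).1 y x
      · exact le_rfl
    · intro x hx
      have hc := (Finset.mem_filter.1 hx).2
      simp only [if_pos hc]
      exact (hS _ hc).2.1 x (hmem x)
    · intro k y
      have hQ0 : 0 ≤ kpow (qe k) n y := kpow_nonneg (hqeP k).1 n y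
      have hpos : (0 : ℝ) < Fintype.card (Finset ι) := by
        exact_mod_cast Fintype.card_pos
      rw [← Finset.sum_fiberwise _ h]
      have hfib : ∀ C : Finset ι,
          ∑ x ∈ Finset.univ.filter (fun x => 2 ≤ (h x).card) with h x = C,
            (if 2 ≤ (h x).card then S (h x) y x else 0) * kpow (p k) n x ≤
          kpow (qe k) n y / Fintype.card (Finset ι) := by
        intro C
        by_cases hC : 2 ≤ C.card ∧ k ∈ C
        · obtain ⟨hC, hkC⟩ := hC
          rw [le_div_iff₀ hpos, mul_comm]
          refine le_trans (mul_le_mul_of_nonneg_left ?_ hpos.le) ((hS C hC).2.2 k hkC y)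
          rw [Finset.sum_congr rfl (g := fun x => S C y x * kpow (p k) n x)]
          · refine Finset.sum_le_sum_of_subset_of_nonneg ?_ fun x _ _ =>
              mul_nonneg ((hS C hC).1 y x) (hp0 k x)
            intro x hx
            have := hmem x
            rwa [(Finset.mem_filter.1 hx).2] at this
          · intro x hx
            rw [(Finset.mem_filter.1 hx).2, if_pos hC]
        · rw [Finset.sum_eq_zero]
          · positivity
          · intro x hx
            rw [(Finset.mem_filter.1 hx).2]
            split_ifs with hc
            · have hk : k ∉ h x := by
                rw [(Finset.mem_filter.1 hx).2]
                exact fun hk => hC ⟨hc, hk⟩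
              have : kpow (p k) n x = 0 := by simpa [hh] using hk
              rw [this, mul_zero]
            · rw [zero_mul]
      refine (Finset.sum_le_sum fun C _ => hfib C).trans_eq ?_
      rw [Finset.sum_const, Finset.card_univ, nsmul_eq_mul]
      field_simp

theorem sum_prod_rpow_stdBasis {d : ℕ} {X : Type} [Fintype X] (u : Fin d → X → ℝ)
    (k : Fin d) (hu : IsProb (u k)) : ∑ x, ∏ j, u j x ^ stdBasis d k j = 1 := by
  rw [← hu.2]
  refine Finset.sum_congr rfl fun x _ => ?_
  rw [Finset.prod_eq_single k (fun j _ hj => by simp [stdBasis, hj]) (by simp)]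
  simp [stdBasis]

/-- asymptotic large-sample / catalytic majorization, minimal
restrictions.  Let `P`, `Q` be `d`-tuples of probability vectors, each with a common
support point, and assume no column support of `P` is contained in another (i.e. `P`
is power universal).  Then (i) the non-strict inequalities for the continuous
monotones `Φ_{α, supp α}` (`α ∈ A_+` not a standard basis vector), (ii) approximate
catalytic majorization with vanishing error, and (iii) approximate large-sample
majorization with vanishing error, are all equivalent. -/
theorem stmt12 {I J : Type} [Fintype I] [Fintype J] (d : ℕ) (hd : 2 ≤ d)
    (p : Fin d → I → ℝ) (q : Fin d → J → ℝ)
    (hp : ∀ k, IsProb (p k)) (hq : ∀ k, IsProb (q k))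
    (hpsup : ∃ x, ∀ k, p k x ≠ 0) (hqsup : ∃ y, ∀ k, q k y ≠ 0)
    (hpu : ∀ k k' : Fin d, k ≠ k' → ¬ ({x | p k x ≠ 0} ⊆ {x | p k' x ≠ 0})) :
    ((∀ α : Fin d → ℝ,
        (∀ k, 0 ≤ α k) → (∑ k, α k = 1) → ¬ (∃ k, α = stdBasis d k) →
        phiAC d α (Finset.univ.filter fun k => α k ≠ 0) p ≤
          phiAC d α (Finset.univ.filter fun k => α k ≠ 0) q) ↔
      (∀ ε : ℝ, 0 < ε →
        ∃ qe : Fin d → J → ℝ,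
          (∀ k, IsProb (qe k)) ∧ (∃ y, ∀ k, qe k y ≠ 0) ∧
          (∀ k, dist1 (q k) (qe k) ≤ ε) ∧
          (∃ (R : Type) (_ : Fintype R) (r : Fin d → R → ℝ),
            (∀ k, IsProb (r k)) ∧ (∃ z, ∀ k, r k z ≠ 0) ∧
            ∃ T : R × J → R × I → ℝ, IsStoch T ∧
              ∀ k y, ∑ x, T y x * kron (r k) (p k) x = kron (r k) (qe k) y) ∧
          (∃ N : ℕ, ∀ n ≥ N,
            ∃ T : CatIdx I J n × J → CatIdx I J n × I → ℝ, IsStoch T ∧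
              ∀ k y, ∑ x, T y x * kron (catVec n (p k) (qe k)) (p k) x
                = kron (catVec n (p k) (qe k)) (qe k) y))) ∧
    ((∀ α : Fin d → ℝ,
        (∀ k, 0 ≤ α k) → (∑ k, α k = 1) → ¬ (∃ k, α = stdBasis d k) →
        phiAC d α (Finset.univ.filter fun k => α k ≠ 0) p ≤
          phiAC d α (Finset.univ.filter fun k => α k ≠ 0) q) ↔
      (∀ ε : ℝ, 0 < ε →
        ∃ qe : Fin d → J → ℝ,
          (∀ k, IsProb (qe k)) ∧ (∃ y, ∀ k, qe k y ≠ 0) ∧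
          (∀ k, dist1 (q k) (qe k) ≤ ε) ∧
          ∃ N : ℕ, ∀ n ≥ N,
            ∃ T : (Fin n → J) → (Fin n → I) → ℝ, IsStoch T ∧
              ∀ k g, ∑ f, T g f * kpow (p k) n f = kpow (qe k) n g)) := by
  have : Nonempty J := ⟨hqsup.choose⟩
  have : Nonempty (Fin d) := ⟨⟨0, by omega⟩⟩
  have hp0 : ∀ k x, 0 ≤ p k x := fun k => (hp k).1
  simp only [phiAC_support]
  have main : (∀ α : Fin d → ℝ, (∀ k, 0 ≤ α k) → (∑ k, α k = 1) →
      ¬ (∃ k, α = stdBasis d k) →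
        ∑ x, ∏ k, p k x ^ α k ≤ ∑ y, ∏ k, q k y ^ α k) → ∀ ε : ℝ, 0 < ε →
      ∃ qe : Fin d → J → ℝ, (∀ k, IsProb (qe k)) ∧ (∃ y, ∀ k, qe k y ≠ 0) ∧
        (∀ k, dist1 (q k) (qe k) ≤ ε) ∧
        ∃ N : ℕ, ∀ n ≥ N, Convertible (fun k => kpow (p k) n) (fun k => kpow (qe k) n) := by
    intro h
    refine exists_convertible_kpow p hp q hq hpu fun α hα hα1 => ?_
    by_cases hb : ∃ k, α = stdBasis d k
    · obtain ⟨k, rfl⟩ := hb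
      rw [sum_prod_rpow_stdBasis p k (hp k), sum_prod_rpow_stdBasis q k (hq k)]
    · exact h α hα hα1 hb
  refine ⟨⟨fun h ε hε => ?_, fun h α hα hα1 _ => ?_⟩, ⟨main, fun h α hα hα1 _ => ?_⟩⟩
  · obtain ⟨qe, hqe, ⟨y₀, hy₀⟩, hdist, N, hN⟩ := main h ε hε
    obtain ⟨x₀, hx₀⟩ := hpsup
    have hcat : ∀ n ≥ N, Convertible (fun k => kron (catVec n (p k) (qe k)) (p k))
        (fun k => kron (catVec n (p k) (qe k)) (qe k)) := fun n hn =>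
      convertible_kron_catVec p qe n (hN (n + 1) (by omega))
    refine ⟨qe, hqe, ⟨y₀, hy₀⟩, hdist, ⟨CatIdx I J N, inferInstance,
      fun k => catVec N (p k) (qe k), fun k => isProb_catVec (hp k) (hqe k) N,
      ⟨⟨0, fun _ => y₀, fun _ => x₀⟩, fun k => ?_⟩, hcat N le_rfl⟩, N, hcat⟩
    refine mul_ne_zero (by positivity) (mul_ne_zero ?_ ?_)
    · exact Finset.prod_ne_zero_iff.2 fun _ _ => hy₀ k
    · exact Finset.prod_ne_zero_iff.2 fun _ _ => hx₀ k
  · refine le_sum_prod_rpow_of_approx α hα q _ fun ε hε => ?_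
    obtain ⟨qe, hqe, -, hdist, ⟨R, _, r, hr, hrsup, T, hT, hTr⟩, -⟩ := h ε hε
    refine ⟨qe, hdist, ?_⟩
    have h1 := sum_prod_rpow_mono α hα hα1 (fun k => kron (r k) (p k))
      (fun k x => mul_nonneg ((hr k).1 _) (hp0 k _)) _ T hT hTr
    rw [sum_prod_rpow_kron α r (fun k => (hr k).1) p hp0,
      sum_prod_rpow_kron α r (fun k => (hr k).1) qe fun k => (hqe k).1] at h1
    exact le_of_mul_le_mul_left h1 (sum_prod_rpow_pos α r (fun k => (hr k).1) hrsup)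
  · refine le_sum_prod_rpow_of_approx α hα q _ fun ε hε => ?_
    obtain ⟨qe, hqe, -, hdist, N, hN⟩ := h ε hε
    refine ⟨qe, hdist, ?_⟩
    obtain ⟨T, hT, hTp⟩ := hN (N + 1) (by omega)
    have h1 := sum_prod_rpow_mono α hα hα1 (fun k => kpow (p k) (N + 1))
      (fun k => kpow_nonneg (hp0 k) _) _ T hT hTp
    rw [sum_prod_rpow_kpow α p hp0, sum_prod_rpow_kpow α qe fun k => (hqe k).1] at h1
    refine le_of_pow_le_pow_left₀ (by omega) ?_ h1
    exact Finset.sum_nonneg fun y _ => Finset.prod_nonneg fun k _ =>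
      Real.rpow_nonneg ((hqe k).1 y) _
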